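/- The sweep map restricts to a bijection from the set of Dyck words A_N to itself, where A_N ⊆ A_Z consists of words all of whose partial sums (levels) are nonnegative. -/

import Mathlib

/-- Modular level of the `j`-th letter (0-indexed) of `w`: sum of the first `j+1` letters in `Fin m`. -/
def modLevel (m : ℕ) [NeZero m] (w : List (Fin m)) (j : ℕ) : Fin m :=
  (w.take (j+1)).sum

/-- The modular sweep map: for k = m-1,…,0, read `w` right-to-left and append letters of level k. -/
def msweep (m : ℕ) [NeZero m] (w : List (Fin m)) : List (Fin m) :=
  ((List.range m).reverse).flatMap (fun k =>
    ((List.range w.length).reverse).filterMap (fun j =>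
      if (modLevel m w j : ℕ) = k then some (w.getD j 0) else none))

/-- The modular presweep map: block `k` consists of the letters of level `k`, read right-to-left. -/
def presweep (m : ℕ) [NeZero m] (w : List (Fin m)) (k : Fin m) : List (Fin m) :=
  ((List.range w.length).reverse).filterMap (fun j =>
    if modLevel m w j = k then some (w.getD j 0) else none)

/-- The forgetful map: concatenate the blocks u*_{m-1} | … | u*_0. -/
def forget {m : ℕ} (P : Fin m → List (Fin m)) : List (Fin m) :=
  (List.finRange m).reverse.flatMap P

/-- One pass of the inverse modular presweep algorithm, returning the removed letters
in removal order (i.e. w_N, w_{N-1}, …), or `none` upon hitting an empty block. -/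
def invPresweepAux {m : ℕ} [NeZero m] :
    ℕ → (Fin m → List (Fin m)) → Fin m → Option (List (Fin m))
  | 0, _, _ => some []
  | n+1, P, l =>
    match P l with
    | [] => none
    | a :: rest => (invPresweepAux n (Function.update P l rest) (l - a)).map (fun ws => a :: ws)

/-- The inverse modular presweep map (Algorithm 2): starts at level |u| mod m. -/
def invPresweep {m : ℕ} [NeZero m] (N : ℕ) (P : Fin m → List (Fin m)) :
    Option (List (Fin m)) :=
  (invPresweepAux N P ((forget P).sum)).map List.reverse

/-- The presweepResidual partitioned word left over when the inverse presweep algorithm stops. -/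
def presweepResidual {m : ℕ} [NeZero m] :
    ℕ → (Fin m → List (Fin m)) → Fin m → (Fin m → List (Fin m))
  | 0, P, _ => P
  | n+1, P, l =>
    match P l with
    | [] => P
    | a :: rest => presweepResidual n (Function.update P l rest) (l - a)

/-- Sum of all letters of a partitioned word, as a natural number. -/
def totalSum {m : ℕ} (P : Fin m → List (Fin m)) : ℕ :=
  ∑ k : Fin m, ((P k).map Fin.val).sum

/-- Number of filled cells in column `j` of the balancing array:
cell (letter a in block k, column j) is filled iff j ∈ {k, k+1, …, k+a-1} mod m. -/
def colCount {m : ℕ} [NeZero m] (P : Fin m → List (Fin m)) (j : Fin m) : ℕ :=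
  ∑ k : Fin m, ((P k).filter (fun a => decide (((j - k : Fin m) : ℕ) < (a : ℕ)))).length

/-- The equitable number of filled cells for column `j`. -/
def eqCount {m : ℕ} [NeZero m] (P : Fin m → List (Fin m)) (j : Fin m) : ℕ :=
  if 1 ≤ (j : ℕ) ∧ (j : ℕ) ≤ totalSum P % m then totalSum P / m + 1 else totalSum P / m

/-- A partitioned word is equitable if every column of its balancing array is equitably filled. -/
def Equitable {m : ℕ} [NeZero m] (P : Fin m → List (Fin m)) : Prop :=
  ∀ j : Fin m, colCount P j = eqCount P j

/-- The list recording, for each position of `forget P`, the index of the block containing it. -/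
def blockList {m : ℕ} (P : Fin m → List (Fin m)) : List (Fin m) :=
  (List.finRange m).reverse.flatMap (fun k => (P k).map (fun _ => k))

/-- The index of the block containing the `i`-th letter (0-indexed) of `forget P`. -/
def blockIdx {m : ℕ} [NeZero m] (P : Fin m → List (Fin m)) (i : ℕ) : ℕ :=
  (((blockList P).getD i 0 : Fin m) : ℕ)

/-- A balanced block-suffix of `P`: a suffix of each block, with letter sum ≡ 0 mod m. -/
def IsBBS {m : ℕ} [NeZero m] (P S : Fin m → List (Fin m)) : Prop :=
  (∀ k, S k <:+ P k) ∧ totalSum S % m = 0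

/-- A left balanced block-suffix: a balanced block-suffix with empty rightmost block. -/
def IsLeftBBS {m : ℕ} [NeZero m] (P S : Fin m → List (Fin m)) : Prop :=
  IsBBS P S ∧ S 0 = []

/-- A minimal left balanced block-suffix: nonempty, and its intersection with any balanced
block-suffix is itself or empty. -/
def MinLeftBBS {m : ℕ} [NeZero m] (P S : Fin m → List (Fin m)) : Prop :=
  IsLeftBBS P S ∧ (∃ k, S k ≠ []) ∧
  ∀ T, IsBBS P T → (∀ k, S k <:+ T k) ∨ (∀ k, S k = [] ∨ T k = [])

/-- Shift the letters of a left balanced block-suffix `S` of `P` one block to the right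
(from block k to block k-1). -/
def shiftBy {m : ℕ} [NeZero m] (P S : Fin m → List (Fin m)) : Fin m → List (Fin m) :=
  fun k => S (k + 1) ++ (P k).take ((P k).length - (S k).length)

/-- One step of the rightmost-partition algorithm (Algorithm 4): with `j` the rightmost
(= smallest-index) column less than equitably filled, move the leftmost letter of block `j-1`
to the end of block `j`. -/
def stepR {m : ℕ} [NeZero m] (P Q : Fin m → List (Fin m)) : Prop :=
  ∃ j : Fin m, colCount P j < eqCount P j ∧
    (∀ j' : Fin m, j' < j → eqCount P j' ≤ colCount P j') ∧
    Q = fun k => if k = j then P j ++ (P (j-1)).take 1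
         else if k = j - 1 then (P (j-1)).tail else P k

/-- One step of the leftmost-partition algorithm (Algorithm 5): with `j` the leftmost
(= largest-index) column more than equitably filled, move the rightmost letter of block `j`
to the front of block `j-1`. -/
def stepL {m : ℕ} [NeZero m] (P Q : Fin m → List (Fin m)) : Prop :=
  ∃ j : Fin m, eqCount P j < colCount P j ∧
    (∀ j' : Fin m, j < j' → colCount P j' ≤ eqCount P j') ∧
    Q = fun k => if k = j then (P j).dropLast
         else if k = j - 1 then (P j).drop ((P j).length - 1) ++ P k else P k

/-- The sum of all letters of a partitioned word in `Fin m`, i.e. |u| mod m. -/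
def totalSumFin {m : ℕ} [NeZero m] (P : Fin m → List (Fin m)) : Fin m :=
  ∑ k : Fin m, (P k).sum

/-- Prepend the letter `i` to block `i + |u|_m` of `P`. -/
def addLetter {m : ℕ} [NeZero m] (P : Fin m → List (Fin m)) (i : Fin m) :
    Fin m → List (Fin m) :=
  fun k => if k = i + totalSumFin P then i :: P k else P k

/-- The n-th level of the complete m-ary tree T*_m of partitioned words. -/
def TreeLevel (m : ℕ) [NeZero m] : ℕ → Set (Fin m → List (Fin m))
  | 0 => {fun _ => []}
  | n+1 => {Q | ∃ P ∈ TreeLevel m n, ∃ i : Fin m, Q = addLetter P i}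

/-- The (integer) level of the `j`-th letter (0-indexed) of a word over ℤ. -/
def zlevel (w : List ℤ) (j : ℕ) : ℤ :=
  (w.take (j+1)).sum

/-- The sequence of levels swept: k = -1, -2, …, then …, 2, 1, 0. -/
def sweepKeys (w : List ℤ) : List ℤ :=
  ((List.range ((w.map Int.natAbs).sum)).map (fun t => -((t : ℤ)+1))) ++
  ((List.range ((w.map Int.natAbs).sum + 1)).reverse.map (fun t => (t : ℤ)))

/-- The sweep map on words over ℤ. -/
def zsweep (w : List ℤ) : List ℤ :=
  (sweepKeys w).flatMap (fun k =>
    ((List.range w.length).reverse).filterMap (fun j =>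
      if zlevel w j = k then some (w.getD j 0) else none))

/-- The set A_ℤ of words containing exactly `e j` copies of `a j` for each `j`. -/
def AZ (n : ℕ) (a : Fin n → ℤ) (e : Fin n → ℕ) : Set (List ℤ) :=
  {w | (w : Multiset ℤ) = ∑ j : Fin n, Multiset.replicate (e j) (a j)}

/-- The set A_ℕ of Dyck words: words of A_ℤ with all levels nonnegative. -/
def ANset (n : ℕ) (a : Fin n → ℤ) (e : Fin n → ℕ) : Set (List ℤ) :=
  {w | w ∈ AZ n a e ∧ ∀ j < w.length, 0 ≤ zlevel w j}

/-- The sequence of levels for the zeta map: k = 0, 1, 2, …, then …, -3, -2, -1. -/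
def zetaKeys (w : List ℤ) : List ℤ :=
  ((List.range ((w.map Int.natAbs).sum + 1)).map (fun t => (t : ℤ))) ++
  ((List.range ((w.map Int.natAbs).sum)).reverse.map (fun t => -((t : ℤ)+1)))

/-- The zeta map: sort the letters of `w` by level, reading left-to-right, for
k = 0,1,2,… and then k = …,-3,-2,-1. -/
def zeta (w : List ℤ) : List ℤ :=
  (zetaKeys w).flatMap (fun k =>
    (List.range w.length).filterMap (fun j =>
      if zlevel w j = k then some (w.getD j 0) else none))

/-- The set of rational Dyck words: -b copies of a, a copies of b, all partial sums ≥ 0. -/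
def Dab (a b : ℤ) : Set (List ℤ) :=
  {w | (w : Multiset ℤ) = Multiset.replicate (-b).toNat a + Multiset.replicate a.toNat b ∧
       ∀ j < w.length, 0 ≤ zlevel w j}

section

open Finset

/-- The permutation `σ` lists the steps of the path with heights `g` by decreasing final height,
and from right to left among steps with the same final height. -/
def IsSweepOrder {N : ℕ} (g : ℕ → ℤ) (σ : Equiv.Perm (Fin N)) : Prop :=
  ∀ i j, i < j → g (σ j + 1) < g (σ i + 1) ∨ (g (σ j + 1) = g (σ i + 1) ∧ σ j < σ i)

theorem IsSweepOrder.antitone {N : ℕ} {g : ℕ → ℤ} {σ : Equiv.Perm (Fin N)}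
    (h : IsSweepOrder g σ) : Antitone fun i => g (σ i + 1) := by
  intro i j hij
  rcases hij.lt_or_eq with hij | rfl
  · rcases h i j hij with h | h
    · exact h.le
    · exact h.1.le
  · exact le_rfl

/-- Telescoping along a path, summed in an arbitrary order. -/
theorem sum_steps_eq {N : ℕ} (g : ℕ → ℤ) (σ : Equiv.Perm (Fin N)) (φ : ℤ → ℤ) :
    ∑ i, (φ (g (σ i + 1)) - φ (g (σ i))) = φ (g N) - φ (g 0) := by
  rw [Equiv.sum_comp σ (fun t : Fin N => φ (g (t + 1)) - φ (g t)),
    Fin.sum_univ_eq_sum_range (fun t => φ (g (t + 1)) - φ (g t)),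
    Finset.sum_range_sub (fun t => φ (g t))]

theorem sum_Ioc_indicator (B x : ℤ) (h₁ : -B ≤ x) (h₂ : x ≤ B) :
    ∑ j ∈ Ioc (-B) B, (if j ≤ x then (1 : ℤ) else 0) = x + B := by
  rw [← Finset.sum_filter]
  have : (Ioc (-B) B).filter (fun j => j ≤ x) = Ioc (-B) x := by
    ext j
    simp only [mem_filter, mem_Ioc]
    omega
  rw [this]
  simp
  omega

/-- Let `L`, `L'` be weakly decreasing assignments of final heights to steps `u`, with the same
net number of crossings of each height. Passing from `L` to the pointwise minimum can move a
starting height below `h` only if it moves a final height below `h`. -/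
theorem exists_final_of_start {N : ℕ} {u L L' : Fin N → ℤ} (hL : Antitone L) (hL' : Antitone L')
    (hbal : ∀ h : ℤ, ∑ i, ((if h ≤ L i then (1 : ℤ) else 0) - if h ≤ L i - u i then 1 else 0) =
      ∑ i, ((if h ≤ L' i then (1 : ℤ) else 0) - if h ≤ L' i - u i then 1 else 0))
    {h : ℤ} {i : Fin N} (hi' : L' i - u i < h) (hi : h ≤ L i - u i) :
    ∃ k, L' k < h ∧ h ≤ L k := by
  by_contra! hno
  let F : (Fin N → ℤ) → ℤ → ℤ := fun M h =>
    ∑ i, ((if h ≤ M i then (1 : ℤ) else 0) - if h ≤ M i - u i then 1 else 0)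
  let M : Fin N → ℤ := fun i => min (L i) (L' i)
  have hle : ∀ j, F L j ≤ F M j := by
    intro j
    by_cases hc : ∀ i, j ≤ L i → j ≤ L' i
    · apply Finset.sum_le_sum
      intro i _
      have := hc i
      simp only [M]
      split_ifs <;> omega
    · push Not at hc
      obtain ⟨k, hk, hk'⟩ := hc
      have hc' : ∀ i, j ≤ L' i → j ≤ L i := by
        intro i hi
        rcases le_total i k with hik | hik
        · exact hk.trans (hL hik)
        · have := hL' hik
          omega
      have : F L j = F L' j := hbal j
      rw [this]
      apply Finset.sum_le_sum
      intro i _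
      have := hc' i
      simp only [M]
      split_ifs <;> omega
  have hlt : F L h < F M h := by
    apply Finset.sum_lt_sum
    · intro i _
      have := hno i
      simp only [M]
      split_ifs <;> omega
    · refine ⟨i, mem_univ _, ?_⟩
      have := hno i
      simp only [M]
      split_ifs <;> omega
  let B : ℤ := ∑ i, (|L i| + |L' i| + |u i|) + |h| + 1
  have hB : ∀ i, |L i| + |L' i| + |u i| < B := by
    intro i
    have := Finset.single_le_sum (f := fun i => |L i| + |L' i| + |u i|)
      (fun i _ => by positivity) (mem_univ i)
    have := abs_nonneg h
    simp only [B]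
    omega
  have htot : ∀ P : Fin N → ℤ, (∀ i, P i = L i ∨ P i = L' i) →
      ∑ j ∈ Ioc (-B) B, F P j = ∑ i, u i := by
    intro P hP
    simp only [F]
    rw [Finset.sum_comm]
    refine Finset.sum_congr rfl fun i _ => ?_
    have := hB i
    rw [Finset.sum_sub_distrib, sum_Ioc_indicator, sum_Ioc_indicator]
    · ring
    all_goals rcases hP i with h | h <;> rw [h] <;> grind
  have hmem : h ∈ Ioc (-B) B := by
    have : 0 ≤ ∑ i, (|L i| + |L' i| + |u i|) := Finset.sum_nonneg fun i _ => by positivity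
    simp only [B, mem_Ioc]
    grind
  have h₁ := Finset.sum_lt_sum (fun j _ => hle j) ⟨h, hmem, hlt⟩
  rw [htot L fun i => Or.inl rfl, htot M fun i => min_choice _ _] at h₁
  exact lt_irrefl _ h₁

theorem IsSweepOrder.level_le {N : ℕ} {g g' : ℕ → ℤ} {σ τ : Equiv.Perm (Fin N)}
    (hσ : IsSweepOrder g σ) (hτ : IsSweepOrder g' τ) (h0 : g 0 = 0) (h0' : g' 0 = 0)
    (hN : g N = g' N) (hg' : ∀ t ≤ N, 0 ≤ g' t)
    (hu : ∀ i, g (σ i + 1) - g (σ i) = g' (τ i + 1) - g' (τ i)) (i : Fin N) :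
    g (σ i + 1) ≤ g' (τ i + 1) := by
  suffices ∀ t : ℕ, ∀ i, (σ i : ℕ) = t → g (σ i + 1) ≤ g' (τ i + 1) from this _ i rfl
  intro t
  induction t using Nat.strong_induction_on with
  | _ t ih =>
    intro i hi
    by_contra! hlt
    have hbal : ∀ h : ℤ, ∑ i, ((if h ≤ g (σ i + 1) then (1 : ℤ) else 0) -
        if h ≤ g (σ i + 1) - (g (σ i + 1) - g (σ i)) then 1 else 0) =
        ∑ i, ((if h ≤ g' (τ i + 1) then (1 : ℤ) else 0) -
        if h ≤ g' (τ i + 1) - (g (σ i + 1) - g (σ i)) then 1 else 0) := by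
      intro h
      have e₁ := sum_steps_eq g σ fun x => if h ≤ x then 1 else 0
      have e₂ := sum_steps_eq g' τ fun x => if h ≤ x then 1 else 0
      rw [h0, hN] at e₁
      rw [h0', ← e₁] at e₂
      simp only [hu, sub_sub_cancel]
      simp only [← hu, sub_sub_cancel]
      exact e₂.symm
    obtain ⟨k, hk', hk⟩ := exists_final_of_start (h := g (σ i)) (i := i)
      hσ.antitone hτ.antitone hbal (by omega) (by omega)
    have hkN := hg' (τ k + 1) (τ k).isLt
    have hkt : t ≤ σ k := by
      by_contra! hc
      have := ih _ hc k rfl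
      omega
    rw [hi] at hk hk'
    obtain - | s := t
    · omega
    have hs : s < N := by have := (σ i).isLt; omega
    have hp : (σ (σ.symm ⟨s, hs⟩) : ℕ) = s := by simp
    have hps := ih s (Nat.lt_succ_self s) _ hp
    rw [hp] at hps
    have hkp : k ≤ σ.symm ⟨s, hs⟩ := by
      by_contra! hc
      rcases hσ _ _ hc with h | ⟨-, h⟩
      · rw [hp] at h
        omega
      · rw [Fin.lt_def, hp] at h
        omega
    have := hτ.antitone hkp
    simp only at this
    omega

/-- A nonnegative path is determined by its sequence of steps in sweep order. -/
theorem IsSweepOrder.perm_eq {N : ℕ} {g g' : ℕ → ℤ} {σ τ : Equiv.Perm (Fin N)}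
    (hσ : IsSweepOrder g σ) (hτ : IsSweepOrder g' τ) (h0 : g 0 = 0) (h0' : g' 0 = 0)
    (hN : g N = g' N) (hg : ∀ t ≤ N, 0 ≤ g t) (hg' : ∀ t ≤ N, 0 ≤ g' t)
    (hu : ∀ i, g (σ i + 1) - g (σ i) = g' (τ i + 1) - g' (τ i)) : σ = τ := by
  have hL : ∀ i, g (σ i + 1) = g' (τ i + 1) := fun i =>
    le_antisymm (hσ.level_le hτ h0 h0' hN hg' hu i)
      (hτ.level_le hσ h0' h0 hN.symm hg (fun i => (hu i).symm) i)
  have key : ∀ d t : ℕ, t + d = N → g t = g' t ∧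
      ∀ s : Fin N, t ≤ s → σ.symm s = τ.symm s := by
    intro d
    induction d with
    | zero =>
      intro t ht
      have : t = N := by omega
      subst this
      exact ⟨hN, fun s hs => absurd s.isLt (by omega)⟩
    | succ d ih =>
      intro t ht
      obtain ⟨hgt, hs⟩ := ih (t + 1) (by omega)
      have htN : t < N := by omega
      set T : Fin N := ⟨t, htN⟩
      have hσT : (σ (σ.symm T) : ℕ) = t := by simp [T]
      have hτT : (τ (τ.symm T) : ℕ) = t := by simp [T]
      have heq : σ.symm T = τ.symm T := by
        have hlev : g (σ (τ.symm T) + 1) = g (σ (σ.symm T) + 1) := by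
          rw [hL, hτT, hσT, hgt]
        rcases lt_trichotomy (σ.symm T) (τ.symm T) with hlt | h | hlt
        · have := hL (σ.symm T)
          have h2 := hL (τ.symm T)
          rcases hτ _ _ hlt with h | ⟨-, h⟩
          · omega
          · have h3 := hs (τ (σ.symm T)) (by rw [Fin.lt_def, hτT] at h; omega)
            rw [Equiv.symm_apply_apply, Equiv.symm_apply_eq] at h3
            rw [h3, Fin.lt_def, hτT, hσT] at h
            omega
        · exact h
        · rcases hσ _ _ hlt with h | ⟨-, h⟩
          · omega
          · have h3 := hs (σ (τ.symm T)) (by rw [Fin.lt_def, hσT] at h; omega)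
            rw [Equiv.symm_apply_apply, eq_comm, Equiv.symm_apply_eq] at h3
            rw [h3, Fin.lt_def, hτT, hσT] at h
            omega
      refine ⟨?_, fun s hst => ?_⟩
      · have h1 := hu (σ.symm T)
        rw [hσT, heq, hτT] at h1
        omega
      · rcases hst.lt_or_eq with h | h
        · exact hs s h
        · have : s = T := Fin.ext h.symm
          rw [this, heq]
  have := (key N 0 (by omega)).2
  apply Equiv.symm_bijective.injective
  ext s
  rw [this s (Nat.zero_le _)]

/-- Reading the steps of a nonnegative path in sweep order gives a nonnegative path. -/
theorem IsSweepOrder.sum_nonneg {N : ℕ} {g : ℕ → ℤ} {σ : Equiv.Perm (Fin N)}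
    (hσ : IsSweepOrder g σ) (h0 : g 0 = 0) (hg : ∀ t ≤ N, 0 ≤ g t) (r : Fin N) :
    0 ≤ ∑ i with i ≤ r, (g (σ i + 1) - g (σ i)) := by
  have hk := hg (σ r + 1) (σ r).isLt
  have e := sum_steps_eq g σ fun x => max (x - g (σ r + 1)) 0
  have : 0 ≤ ∑ i, (max (g (σ i + 1) - g (σ r + 1)) 0 - max (g (σ i) - g (σ r + 1)) 0) := by
    rw [e, h0]
    omega
  refine this.trans ?_
  rw [Finset.sum_filter]
  apply Finset.sum_le_sum
  intro i _
  split_ifs with hi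
  · have := hσ.antitone hi
    simp only at this
    omega
  · have := hσ.antitone (le_of_not_ge hi)
    simp only at this
    omega

end

theorem sum_take_add_one (w : List ℤ) (t : ℕ) :
    (w.take (t + 1)).sum = (w.take t).sum + w.getD t 0 := by
  by_cases h : t < w.length
  · rw [List.sum_take_succ _ _ h, List.getD_eq_getElem _ _ h]
  · rw [List.take_of_length_le (by omega), List.take_of_length_le (by omega),
      List.getD_eq_default _ _ (by omega), add_zero]

theorem sum_take_nonneg {w : List ℤ} (hw : ∀ j < w.length, 0 ≤ zlevel w j) :
    ∀ t ≤ w.length, 0 ≤ (w.take t).sum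
  | 0, _ => by simp
  | t + 1, ht => hw t ht

theorem abs_sum_take_le (w : List ℤ) (t : ℕ) :
    |(w.take t).sum| ≤ ((w.map Int.natAbs).sum : ℕ) := by
  induction w generalizing t with
  | nil => simp
  | cons a w ih =>
    cases t with
    | zero => simp only [List.take_zero, List.sum_nil, abs_zero]; exact Int.natCast_nonneg _
    | succ t =>
      have := ih t
      simp only [List.take_succ_cons, List.sum_cons, List.map_cons] at *
      push_cast at *
      grind

theorem sweepKeys_eq (w : List ℤ) :
    sweepKeys w = ((List.range (w.map Int.natAbs).sum).map fun t : ℕ => -((t : ℤ) + 1)) ++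
      (List.range ((w.map Int.natAbs).sum + 1)).reverse.map fun t : ℕ => (t : ℤ) := by
  simp [sweepKeys, ← List.map_eq_flatMap, Function.comp_def]

/-- The positions of the letters of `w`, in the order in which `zsweep` reads them. -/
def sweepPositions (w : List ℤ) : List ℕ :=
  (sweepKeys w).flatMap fun k => (List.range w.length).reverse.filter fun j => zlevel w j = k

theorem zsweep_eq_map (w : List ℤ) :
    zsweep w = (sweepPositions w).map fun j => w.getD j 0 := by
  rw [zsweep, sweepPositions, List.map_flatMap]
  congr 1
  funext k
  generalize (List.range w.length).reverse = l
  induction l with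
  | nil => rfl
  | cons a l ih =>
    rw [List.filterMap_cons, List.filter_cons, ih]
    by_cases h : zlevel w a = k <;> simp [h]

theorem mem_sweepPositions {w : List ℤ} {j : ℕ} : j ∈ sweepPositions w ↔ j < w.length := by
  have := abs_sum_take_le w (j + 1)
  simp only [sweepPositions, List.mem_flatMap, List.mem_filter, List.mem_reverse, List.mem_range,
    decide_eq_true_eq]
  refine ⟨fun ⟨_, _, h, _⟩ => h, fun h => ⟨zlevel w j, ?_, h, rfl⟩⟩
  rw [abs_le] at this
  simp only [sweepKeys_eq, zlevel, List.mem_append, List.mem_map, List.mem_reverse, List.mem_range]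
  rcases lt_or_ge (w.take (j + 1)).sum 0 with h | h
  · exact Or.inl ⟨(-(w.take (j + 1)).sum - 1).toNat, by omega, by omega⟩
  · exact Or.inr ⟨((w.take (j + 1)).sum).toNat, by omega, by omega⟩

theorem pairwise_sweepPositions {w : List ℤ} (hw : ∀ j < w.length, 0 ≤ zlevel w j) :
    (sweepPositions w).Pairwise fun i j =>
      zlevel w j < zlevel w i ∨ (zlevel w j = zlevel w i ∧ j < i) := by
  rw [sweepPositions, List.pairwise_flatMap]
  constructor
  · intro k _
    have h : ((List.range w.length).reverse.filter fun j => zlevel w j = k).Pairwise (· > ·) :=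
      List.Pairwise.filter _ (List.pairwise_reverse.2 List.pairwise_lt_range)
    refine h.imp_of_mem fun {i j} hi hj hij => Or.inr ⟨?_, hij⟩
    simp only [List.mem_filter, decide_eq_true_eq] at hi hj
    rw [hi.2, hj.2]
  · have h : (sweepKeys w).Pairwise fun a b => a < 0 ∨ b < a := by
      rw [sweepKeys_eq, List.pairwise_append, List.pairwise_map, List.pairwise_map,
        List.pairwise_reverse]
      refine ⟨List.pairwise_of_forall fun _ _ => by omega,
        List.pairwise_lt_range.imp fun h => by omega, ?_⟩
      intro a ha b _
      simp only [List.mem_map] at ha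
      omega
    refine h.imp fun {a b} hab i hi j hj => Or.inl ?_
    simp only [List.mem_filter, List.mem_reverse, List.mem_range, decide_eq_true_eq] at hi hj
    have := hw i hi.1
    omega

theorem exists_isSweepOrder {w : List ℤ} {N : ℕ} (hN : w.length = N)
    (hw : ∀ j < w.length, 0 ≤ zlevel w j) :
    ∃ σ : Equiv.Perm (Fin N), IsSweepOrder (fun t => (w.take t).sum) σ ∧
      zsweep w = List.ofFn fun i => w.getD (σ i) 0 := by
  subst hN
  have hp := pairwise_sweepPositions hw
  have hnd : (sweepPositions w).Nodup := hp.imp fun {i j} h => by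
    rintro rfl
    omega
  have hlen : (sweepPositions w).length = w.length := by
    have : (sweepPositions w).Perm (List.range w.length) :=
      (List.perm_ext_iff_of_nodup hnd List.nodup_range).2 fun j => by
        rw [mem_sweepPositions, List.mem_range]
    simpa using this.length_eq
  let f : Fin w.length → Fin w.length := fun i =>
    ⟨(sweepPositions w)[i], mem_sweepPositions.1 (List.getElem_mem _)⟩
  have hf : Function.Injective f := by
    intro i j hij
    simpa [f, hnd.getElem_inj_iff, Fin.ext_iff] using hij
  refine ⟨Equiv.ofBijective f (Finite.injective_iff_bijective.1 hf), ?_, ?_⟩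
  · intro i j hij
    exact List.pairwise_iff_getElem.1 hp i j (by omega) (by omega) hij
  · rw [zsweep_eq_map]
    apply List.ext_getElem
    · simp [hlen]
    · intro i _ _
      simp [f]

theorem zsweep_perm {w : List ℤ} (hw : ∀ j < w.length, 0 ≤ zlevel w j) : (zsweep w).Perm w := by
  obtain ⟨σ, -, h⟩ := exists_isSweepOrder rfl hw
  rw [h]
  have := Equiv.Perm.ofFn_comp_perm σ fun i : Fin w.length => w.getD i 0
  refine this.trans (List.Perm.of_eq ?_)
  simp

theorem zlevel_zsweep_nonneg {w : List ℤ} (hw : ∀ j < w.length, 0 ≤ zlevel w j)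
    (j : ℕ) (hj : j < (zsweep w).length) : 0 ≤ zlevel (zsweep w) j := by
  rw [(zsweep_perm hw).length_eq] at hj
  obtain ⟨σ, hσ, h⟩ := exists_isSweepOrder rfl hw
  rw [zlevel, h, List.sum_take_ofFn]
  convert hσ.sum_nonneg (by simp) (sum_take_nonneg hw) ⟨j, hj⟩ using 2
  · ext i
    simp [Fin.le_def]
  · rw [sum_take_add_one, add_sub_cancel_left]

theorem zsweep_injOn : Set.InjOn zsweep {w | ∀ j < w.length, 0 ≤ zlevel w j} := by
  intro w hw w' hw' h
  have hlen : w'.length = w.length := by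
    rw [← (zsweep_perm hw).length_eq, ← (zsweep_perm hw').length_eq, h]
  obtain ⟨σ, hσ, e⟩ := exists_isSweepOrder rfl hw
  obtain ⟨τ, hτ, e'⟩ := exists_isSweepOrder hlen hw'
  have hu : ∀ i, w.getD (σ i) 0 = w'.getD (τ i) 0 :=
    congrFun (List.ofFn_injective (e.symm.trans (h.trans e')))
  have hsum : w.sum = w'.sum := by
    rw [← (zsweep_perm hw).sum_eq, ← (zsweep_perm hw').sum_eq, h]
  have hστ : σ = τ := by
    refine hσ.perm_eq hτ (by simp) (by simp) ?_ (sum_take_nonneg hw)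
      (hlen ▸ sum_take_nonneg hw') fun i => ?_
    · simp only [List.take_length, hsum]
      rw [List.take_of_length_le hlen.le]
    · rw [sum_take_add_one, sum_take_add_one, add_sub_cancel_left, add_sub_cancel_left, hu]
  subst hστ
  apply List.ext_getElem hlen.symm
  intro i hi hi'
  simpa [hi, hi'] using hu (σ.symm ⟨i, hi⟩)

theorem finite_AZ (n : ℕ) (a : Fin n → ℤ) (e : Fin n → ℕ) : (AZ n a e).Finite := by
  refine (List.finite_toSet
    (∑ j : Fin n, Multiset.replicate (e j) (a j)).toList.permutations).subset fun w hw => ?_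
  simp only [Set.mem_ofPred_eq, List.mem_permutations]
  rw [← Multiset.coe_eq_coe, Multiset.coe_toList]
  exact hw

/-- The sweep map restricts to a bijection from the set of Dyck words
(words of A_ℤ with all partial sums nonnegative) to itself. -/
theorem sweep_bijective_on_dyck (n : ℕ) (a : Fin n → ℤ) (e : Fin n → ℕ) :
    Set.BijOn zsweep (ANset n a e) (ANset n a e) := by
  refine (Set.Finite.injOn_iff_bijOn_of_mapsTo
    ((finite_AZ n a e).subset fun _ hw => hw.1) ?_).1 (zsweep_injOn.mono fun _ hw => hw.2)
  intro w hw
  exact ⟨(Multiset.coe_eq_coe.2 (zsweep_perm hw.2)).trans hw.1, zlevel_zsweep_nonneg hw.2⟩
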